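/- Fix n ∈ ℕ. Let T be a ternary form of degree d = 8+2n with a decomposition A = {P_1,…,P_r} ⊂ ℙ^2 of length r ≤ 11+3n. If there is a subset A' ⊆ A with ℓ(A') ≥ 9+2n whose points all lie on a conic (the zero locus of a nonzero homogeneous form of degree 2), then T admits infinitely many pairwise distinct decompositions of length r (a positive-dimensional family {A_t} of decompositions of T with A_0 = A). -/

import Mathlib

open MvPolynomial
open scoped Classical

noncomputable section

/-- Points of the projective space `ℙ^m` over `ℂ`. -/
abbrev Pt (m : ℕ) := Projectivization ℂ (Fin (m + 1) → ℂ)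

/-- The linear form with coefficient vector `v`. -/
def linForm {m : ℕ} (v : Fin (m + 1) → ℂ) : MvPolynomial (Fin (m + 1)) ℂ :=
  ∑ i, C (v i) * X i

/-- The degree-`d` Veronese image of a projective point, i.e. the `d`-th power `L^d`
of a linear form `L` representing the point. -/
def powRep {m : ℕ} (d : ℕ) (P : Pt m) : MvPolynomial (Fin (m + 1)) ℂ :=
  linForm P.rep ^ d

/-- `A ⊆ ℙ^m` is a decomposition of the form `T` of degree `d`:
`T = a_1 L_1^d + ⋯ + a_r L_r^d`. -/
def IsDecomp {m : ℕ} (d : ℕ) (A : Finset (Pt m))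
    (T : MvPolynomial (Fin (m + 1)) ℂ) : Prop :=
  ∃ a : Pt m → ℂ, T = ∑ P ∈ A, a P • powRep d P

/-- A decomposition is non-redundant if `T` is not in the span of `ν_d(A')`
for any proper subset `A' ⊊ A`. -/
def NonRedundant {m : ℕ} (d : ℕ) (A : Finset (Pt m))
    (T : MvPolynomial (Fin (m + 1)) ℂ) : Prop :=
  ∀ A' : Finset (Pt m), A' ⊂ A →
    T ∉ Submodule.span ℂ (powRep d '' (A' : Set (Pt m)))

/-- The Cayley–Bacharach property `CB(d)`. -/
def CB {m : ℕ} (d : ℕ) (Z : Finset (Pt m)) : Prop :=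
  ∀ P ∈ Z, ∀ F : MvPolynomial (Fin (m + 1)) ℂ, F.IsHomogeneous d →
    (∀ Q ∈ Z.erase P, eval Q.rep F = 0) → eval P.rep F = 0

/-- The `d`-th Kruskal rank of a finite set `Z ⊂ ℙ^m`: the largest `k` (at most `ℓ(Z)`)
such that the Veronese images of every subset of `Z` of cardinality at most `k`
are linearly independent. -/
def kruskalRank {m : ℕ} (d : ℕ) (Z : Finset (Pt m)) : ℕ :=
  sSup {k | k ≤ Z.card ∧ ∀ S ⊆ Z, S.card ≤ k →
    LinearIndependent ℂ (fun P : S => powRep d P.1)}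

/-- The evaluation map of degree `d` on (representatives of) the points of `Z`. -/
def evalMap {m : ℕ} (Z : Finset (Pt m)) (d : ℕ) :
    homogeneousSubmodule (Fin (m + 1)) ℂ d →ₗ[ℂ] (Z → ℂ) where
  toFun F P := eval (P : Pt m).rep F.1
  map_add' F G := by funext P; simp
  map_smul' c F := by funext P; simp [smul_eq_C_mul]

/-- The Hilbert function of a finite set of points `Z ⊂ ℙ^m`. -/
def hf {m : ℕ} (Z : Finset (Pt m)) (d : ℕ) : ℕ :=
  Module.finrank ℂ (LinearMap.range (evalMap Z d))

/-- The first difference of the Hilbert function (with `h_Z(j) = 0` for `j < 0`). -/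
def Dhf {m : ℕ} (Z : Finset (Pt m)) (j : ℕ) : ℤ :=
  if j = 0 then (hf Z 0 : ℤ) else (hf Z j : ℤ) - (hf Z (j - 1) : ℤ)

section keyone
open Polynomial

lemma key_pencil (M : ℕ) (g h : ℂ[X]) (hg : g.Monic) (hgd : g.natDegree = M + 1)
    (hsep : g.Separable) (hh : h ≠ 0) (hhd : h.degree < (M + 1 : ℕ)) :
    {S : Finset ℂ | S.card = M + 1 ∧ ∃ ε : ℂ,
      g + Polynomial.C ε * h = ∏ t ∈ S, (Polynomial.X - Polynomial.C t)}.Infinite := by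
  set G : ℂ → ℂ[X] := fun ε => g + Polynomial.C ε * h with hG
  have hdlt : ∀ ε, (Polynomial.C ε * h).degree < g.degree := by
    intro ε
    rw [Polynomial.degree_eq_natDegree hg.ne_zero, hgd]
    refine lt_of_le_of_lt ?_ hhd
    by_cases h0 : ε = 0
    · simp [h0]
    · rw [Polynomial.degree_C_mul h0]
  have hGm : ∀ ε, (G ε).Monic := fun ε => hg.add_of_left (hdlt ε)
  have hGd : ∀ ε, (G ε).natDegree = M + 1 := fun ε => by
    rw [hG]; simp only; rw [Polynomial.natDegree_add_eq_left_of_degree_lt (hdlt ε), hgd]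
  set W : ℂ[X] := g * derivative h - derivative g * h with hW
  have hW0 : W ≠ 0 := by
    intro h0
    have h1 : g ∣ derivative g * h := ⟨derivative h, (sub_eq_zero.1 h0).symm⟩
    have h2 : g ∣ h := IsCoprime.dvd_of_dvd_mul_left hsep h1
    have h3 := Polynomial.degree_le_of_dvd h2 hh
    rw [Polynomial.degree_eq_natDegree hg.ne_zero, hgd] at h3
    exact absurd hhd (not_lt.2 h3)
  set bad : Set ℂ := {ε | ∃ x, (G ε).eval x = 0 ∧ (derivative (G ε)).eval x = 0} with hbad
  have hbadfin : bad.Finite := by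
    have hsub : bad ⊆ ⋃ x ∈ (W.roots.toFinset : Set ℂ),
        {ε | (G ε).eval x = 0 ∧ (derivative (G ε)).eval x = 0} := by
      rintro ε ⟨x, h1, h2⟩
      simp only [Set.mem_iUnion]
      refine ⟨x, ?_, h1, h2⟩
      simp only [Finset.mem_coe, Multiset.mem_toFinset]
      rw [Polynomial.mem_roots hW0, Polynomial.IsRoot]
      simp only [hG, hW, derivative_add, derivative_mul, derivative_C, Polynomial.eval_add, Polynomial.eval_mul, Polynomial.eval_C,
        Polynomial.eval_sub, zero_mul, zero_add] at *
      linear_combination (derivative h).eval x * h1 - h.eval x * h2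
    refine Set.Finite.subset (Set.Finite.biUnion (Finset.finite_toSet _) ?_) hsub
    intro x _
    apply Set.Subsingleton.finite
    rintro ε ⟨h1, h2⟩ ε' ⟨h1', h2'⟩
    by_contra hne
    simp only [hG, derivative_add, derivative_mul, derivative_C, Polynomial.eval_add, Polynomial.eval_mul, Polynomial.eval_C,
        zero_mul, zero_add] at *
    have hne' : ε - ε' ≠ 0 := sub_ne_zero.2 hne
    have e1 : h.eval x = 0 := by
      apply mul_left_cancel₀ hne'; linear_combination h1 - h1'
    have e2 : (derivative h).eval x = 0 := by
      apply mul_left_cancel₀ hne'; linear_combination h2 - h2'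
    rw [e1] at h1; rw [e2] at h2
    obtain ⟨a, b, hab⟩ := hsep
    have := congrArg (Polynomial.eval x) hab
    simp only [Polynomial.eval_add, Polynomial.eval_mul, Polynomial.eval_one] at this
    rw [show g.eval x = 0 by simpa using h1, show (derivative g).eval x = 0 by simpa using h2] at this
    simp at this
  have hgood : badᶜ.Infinite := hbadfin.infinite_compl
  have hprod : ∀ ε ∈ badᶜ, (G ε).roots.toFinset.card = M + 1 ∧
      G ε = ∏ t ∈ (G ε).roots.toFinset, (Polynomial.X - Polynomial.C t) := by
    intro ε hε
    have hc : (G ε).roots.card = (G ε).natDegree :=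
      Polynomial.splits_iff_card_roots.1 (IsAlgClosed.splits _)
    have hnd : (G ε).roots.Nodup := by
      rw [Multiset.nodup_iff_count_le_one]
      intro x
      rw [Polynomial.count_roots]
      by_contra hlt
      push Not at hlt
      rw [Polynomial.one_lt_rootMultiplicity_iff_isRoot (hGm ε).ne_zero] at hlt
      exact hε ⟨x, hlt⟩
    refine ⟨?_, ?_⟩
    · rw [Multiset.toFinset_card_of_nodup hnd, hc, hGd]
    · conv_lhs => rw [← Polynomial.prod_multiset_X_sub_C_of_monic_of_roots_card_eq (hGm ε) hc]
      rw [Finset.prod, Multiset.toFinset_val, hnd.dedup]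
  have hinj : Set.InjOn (fun ε => (G ε).roots.toFinset) badᶜ := by
    intro ε hε ε' hε' heq
    simp only at heq
    have h1 : G ε = G ε' := by rw [(hprod ε hε).2, heq, ← (hprod ε' hε').2]
    have h2 : Polynomial.C ε * h = Polynomial.C ε' * h := add_left_cancel h1
    exact Polynomial.C_injective (mul_right_cancel₀ hh h2)
  refine (hgood.image hinj).mono ?_
  rintro _ ⟨ε, hε, rfl⟩
  exact ⟨(hprod ε hε).1, ε, (hprod ε hε).2⟩

lemma key_one (M : ℕ) (S : Finset ℂ) (hS : S.card = M + 1) (a : ℂ → ℂ) :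
    {S' : Finset ℂ | S'.card = M + 1 ∧ ∃ b : ℂ → ℂ, ∀ j ≤ 2 * M,
      ∑ t ∈ S, a t * t ^ j = ∑ t ∈ S', b t * t ^ j}.Infinite := by
  let Λ : ℂ[X] →ₗ[ℂ] ℂ := ∑ t ∈ S, a t • Polynomial.leval t
  have hΛ : ∀ p : ℂ[X], Λ p = ∑ t ∈ S, a t * p.eval t := by
    intro p; simp [Λ, LinearMap.sum_apply]
  let g : ℂ[X] := ∏ t ∈ S, (Polynomial.X - Polynomial.C t)
  have hgm : g.Monic := Polynomial.monic_prod_of_monic _ _ (fun t _ => Polynomial.monic_X_sub_C t)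
  have hgd : g.natDegree = M + 1 := by
    simp only [g]; rw [Polynomial.natDegree_prod_of_monic _ _ (fun t _ => Polynomial.monic_X_sub_C t)]
    simp [hS]
  have hsep : g.Separable := by
    refine Polynomial.separable_prod_X_sub_C_iff'.2 ?_
    intro x _ y _ h; exact h
  have hgL : ∀ q, Λ (g * q) = 0 := by
    intro q
    rw [hΛ]
    refine Finset.sum_eq_zero fun t ht => ?_
    have : g.eval t = 0 := by
      simp only [g, Polynomial.eval_prod]
      exact Finset.prod_eq_zero ht (by simp)
    simp [this]
  obtain ⟨h, hh0, hhd, hhL⟩ : ∃ h : ℂ[X], h ≠ 0 ∧ h.degree < (M + 1 : ℕ) ∧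
      ∀ j < M, Λ (h * Polynomial.X ^ j) = 0 := by
    let f : (Polynomial.degreeLT ℂ (M + 1)) →ₗ[ℂ] (Fin M → ℂ) :=
      LinearMap.pi (fun j => Λ ∘ₗ (LinearMap.mulRight ℂ (Polynomial.X ^ (j : ℕ))) ∘ₗ
        (Polynomial.degreeLT ℂ (M + 1)).subtype)
    have : FiniteDimensional ℂ (Polynomial.degreeLT ℂ (M + 1)) :=
      Module.Finite.equiv (Polynomial.degreeLTEquiv ℂ (M + 1)).symm
    have hker : LinearMap.ker f ≠ ⊥ := by
      apply LinearMap.ker_ne_bot_of_finrank_lt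
      rw [(Polynomial.degreeLTEquiv ℂ (M + 1)).finrank_eq]
      simp
    obtain ⟨⟨h, hm⟩, hk, hne⟩ := Submodule.exists_mem_ne_zero_of_ne_bot hker
    refine ⟨h, fun h0 => hne (by simpa using h0), Polynomial.mem_degreeLT.1 hm, fun j hj => ?_⟩
    have := congrFun (LinearMap.mem_ker.1 hk) ⟨j, hj⟩
    simpa [f] using this
  refine (key_pencil M g h hgm hgd hsep hh0 hhd).mono ?_
  rintro S' ⟨hc, ε, hε⟩
  refine ⟨hc, fun u => Λ (Lagrange.basis S' id u), fun j hj => ?_⟩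
  set G := g + Polynomial.C ε * h with hG
  have hGm : G.Monic := by
    rw [hε]; exact Polynomial.monic_prod_of_monic _ _ (fun t _ => Polynomial.monic_X_sub_C t)
  have hGd : G.natDegree = M + 1 := by
    rw [hε, Polynomial.natDegree_prod_of_monic _ _ (fun t _ => Polynomial.monic_X_sub_C t)]
    simp [hc]
  have hGL : ∀ i < M, Λ (G * Polynomial.X ^ i) = 0 := by
    intro i hi
    rw [hG, add_mul, map_add, hgL, mul_assoc, ← Polynomial.smul_eq_C_mul, map_smul, hhL i hi]
    simp
  set p : ℂ[X] := Polynomial.X ^ j with hp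
  have hmod := Polynomial.modByMonic_add_div p G
  have hq : Λ (G * (p /ₘ G)) = 0 := by
    by_cases hz : p /ₘ G = 0
    · simp [hz]
    have hqd : (p /ₘ G).natDegree < M := by
      have h1 : ¬ (p.natDegree < G.natDegree) := by
        intro hlt
        apply hz
        rw [Polynomial.divByMonic_eq_zero_iff hGm]
        exact Polynomial.degree_lt_degree hlt
      rw [Polynomial.natDegree_divByMonic _ hGm, hGd]
      rw [hGd] at h1
      simp only [hp, Polynomial.natDegree_X_pow] at *
      omega
    rw [Polynomial.as_sum_range' (p /ₘ G) M hqd, Finset.mul_sum, map_sum]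
    refine Finset.sum_eq_zero fun i hi => ?_
    rw [← Polynomial.C_mul_X_pow_eq_monomial, mul_left_comm, ← Polynomial.smul_eq_C_mul, map_smul,
      hGL i (Finset.mem_range.1 hi), smul_zero]
  have hrd : (p %ₘ G).degree < S'.card := by
    have := Polynomial.degree_modByMonic_lt p hGm
    rwa [Polynomial.degree_eq_natDegree hGm.ne_zero, hGd, ← hc] at this
  have hr := Lagrange.eq_interpolate (v := id) (Set.injOn_id _) hrd
  have e1 : Λ p = Λ (p %ₘ G) := by
    conv_lhs => rw [← hmod]
    rw [map_add, hq, add_zero]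
  have e2 : ∀ u ∈ S', (p %ₘ G).eval u = u ^ j := by
    intro u hu
    have : G.eval u = 0 := by
      rw [hε, Polynomial.eval_prod]; exact Finset.prod_eq_zero hu (by simp)
    have h2 := congrArg (Polynomial.eval u) hmod
    rw [Polynomial.eval_add, Polynomial.eval_mul, this] at h2
    simpa [hp] using h2
  have e3 : ∑ t ∈ S, a t * t ^ j = Λ p := by rw [hΛ]; simp [hp]
  rw [e3, e1, hr, Lagrange.interpolate_apply, map_sum]
  refine Finset.sum_congr rfl fun u hu => ?_
  rw [← Polynomial.smul_eq_C_mul, map_smul]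
  simp only [id]
  rw [e2 u hu, smul_eq_mul, mul_comm]

end keyone

lemma infinite_of_le {d r : ℕ} {T : MvPolynomial (Fin 3) ℂ}
    (h : {B : Finset (Pt 2) | IsDecomp d B T ∧ B.card ≤ r}.Infinite) :
    {B : Finset (Pt 2) | IsDecomp d B T ∧ B.card = r}.Infinite := by
  have hInf : Infinite (Pt 2) := by
    by_contra hfin
    rw [not_infinite_iff_finite] at hfin
    exact h (Set.toFinite _)
  by_cases hex : ∃ B : Finset (Pt 2), IsDecomp d B T ∧ B.card < r
  · obtain ⟨B, ⟨a, ha⟩, hB⟩ := hex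
    obtain ⟨F, hF, hFc⟩ := Infinite.exists_superset_card_eq B (r - 1) (by omega)
    have hcompl : ((F : Set (Pt 2))ᶜ).Infinite := (Finset.finite_toSet F).infinite_compl
    have hinj : Set.InjOn (fun P => insert P F) ((F : Set (Pt 2))ᶜ) := by
      intro P hP P' hP' heq
      simp only at heq
      have : P ∈ insert P' F := heq ▸ Finset.mem_insert_self P F
      rcases Finset.mem_insert.1 this with h | h
      · exact h
      · exact absurd h (by simpa using hP)
    refine (hcompl.image hinj).mono ?_
    rintro _ ⟨P, hP, rfl⟩
    have hP' : P ∉ F := by simpa using hP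
    refine ⟨⟨fun R => if R ∈ B then a R else 0, ?_⟩, ?_⟩
    · rw [ha]
      have hsub : B ⊆ insert P F := hF.trans (Finset.subset_insert _ _)
      rw [← Finset.sum_subset hsub]
      · exact Finset.sum_congr rfl fun R hR => by simp [hR]
      · intro R _ hR; simp [hR]
    · rw [Finset.card_insert_of_notMem hP', hFc]; omega
  · push Not at hex
    refine h.mono ?_
    rintro B ⟨h1, h2⟩
    exact ⟨h1, le_antisymm h2 (hex B h1)⟩

/-- spanning with arbitrary representatives -/
lemma isDecomp_of_sum {d : ℕ} (B : Finset (Pt 2)) {T : MvPolynomial (Fin 3) ℂ}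
    (h : T ∈ Submodule.span ℂ (powRep d '' (B : Set (Pt 2)))) : IsDecomp d B T := by
  obtain ⟨c, hc⟩ := (Submodule.mem_span_image_finset_iff_exists_fun ℂ).1 h
  refine ⟨fun P => if hP : P ∈ B then c ⟨P, hP⟩ else 0, ?_⟩
  rw [← hc, ← Finset.sum_coe_sort B]
  exact Finset.sum_congr rfl fun P _ => by simp

lemma linForm_smul {m : ℕ} (c : ℂ) (v : Fin (m + 1) → ℂ) :
    linForm (c • v) = C c * linForm v := by
  simp [linForm, Finset.mul_sum, mul_assoc]

lemma powRep_mk {d : ℕ} (v : Fin 3 → ℂ) (hv : v ≠ 0) :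
    ∃ c : ℂ, c ≠ 0 ∧ linForm (m := 2) v ^ d = c • powRep d (Projectivization.mk ℂ v hv : Pt 2) := by
  obtain ⟨a, ha⟩ := Projectivization.exists_smul_eq_mk_rep ℂ v hv
  refine ⟨((a : ℂ) ^ d)⁻¹, by simp, ?_⟩
  have : (Projectivization.mk ℂ v hv : Pt 2).rep = (a : ℂ) • v := ha.symm
  rw [powRep, this, linForm_smul, mul_pow, ← C_pow, ← smul_eq_C_mul, smul_smul,
    inv_mul_cancel₀ (by simp), one_smul]

/-- main lemma on an affine polynomial parametrization -/
lemma affine_param {d e M : ℕ} (hM : e * d = 2 * M) (Φ : Fin 3 → Polynomial ℂ)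
    (hΦ : ∀ i, (Φ i).natDegree ≤ e)
    (φ : ℂ → Fin 3 → ℂ) (hφ : ∀ t i, φ t i = (Φ i).eval t)
    (hne : ∀ t, φ t ≠ 0)
    (hinj : Function.Injective (fun t => (Projectivization.mk ℂ (φ t) (hne t) : Pt 2)))
    (T : MvPolynomial (Fin 3) ℂ) (A A' : Finset (Pt 2)) (hA : IsDecomp d A T) (hA' : A' ⊆ A)
    (hcard : A'.card = M + 1)
    (hcov : ∀ P ∈ A', ∃ t, Projectivization.mk ℂ (φ t) (hne t) = P) :
    {B : Finset (Pt 2) | IsDecomp d B T ∧ B.card = A.card}.Infinite := by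
  apply infinite_of_le
  set ψ : ℂ → Pt 2 := fun t => Projectivization.mk ℂ (φ t) (hne t) with hψ
  -- expansion
  obtain ⟨W, hW⟩ : ∃ W : ℕ → MvPolynomial (Fin 3) ℂ, ∀ t,
      linForm (m := 2) (φ t) ^ d = ∑ j ∈ Finset.range (2 * M + 1), (t ^ j) • W j := by
    let F : Polynomial (MvPolynomial (Fin 3) ℂ) :=
      ∑ i, (Φ i).map C * Polynomial.C (X i)
    have hF : F.natDegree ≤ e := by
      refine Polynomial.natDegree_sum_le_of_forall_le _ _ fun i _ => ?_
      refine (Polynomial.natDegree_mul_C_le _ _).trans ?_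
      exact (Polynomial.natDegree_map_le).trans (hΦ i)
    have hFd : (F ^ d).natDegree < 2 * M + 1 := by
      have := Polynomial.natDegree_pow_le (p := F) (n := d)
      have h2 : d * F.natDegree ≤ d * e := Nat.mul_le_mul_left _ hF
      rw [mul_comm d e] at h2
      omega
    refine ⟨fun j => (F ^ d).coeff j, fun t => ?_⟩
    have h1 := Polynomial.eval_eq_sum_range' hFd (C t)
    have h2 : Polynomial.eval (C t) F = linForm (m := 2) (φ t) := by
      simp only [F, linForm, Polynomial.eval_finsetSum, Polynomial.eval_mul, Polynomial.eval_C]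
      refine Finset.sum_congr rfl fun i _ => ?_
      rw [Polynomial.eval_map, hφ, Polynomial.eval₂_hom]
    rw [Polynomial.eval_pow, h2] at h1
    rw [h1]
    refine Finset.sum_congr rfl fun j _ => ?_
    rw [smul_eq_C_mul, C_pow, mul_comm]
  obtain ⟨a, ha⟩ := hA
  choose c hc0 hc using fun t => powRep_mk (d := d) (φ t) (hne t)
  set S : Finset ℂ := A'.preimage ψ hinj.injOn with hS
  have hSim : S.image ψ = A' := by
    rw [hS, Finset.image_preimage]
    refine Finset.filter_true_of_mem fun P hP => ?_
    obtain ⟨t, ht⟩ := hcov P hP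
    exact ⟨t, ht⟩
  have hScard : S.card = M + 1 := by
    rw [← hcard, ← hSim, Finset.card_image_of_injective _ hinj]
  have hsumA' : ∑ P ∈ A', a P • powRep d P
      = ∑ t ∈ S, (a (ψ t) * (c t)⁻¹) • linForm (m := 2) (φ t) ^ d := by
    rw [← hSim, Finset.sum_image (fun x _ y _ h => hinj h)]
    refine Finset.sum_congr rfl fun t _ => ?_
    rw [hc t, smul_smul, mul_assoc, inv_mul_cancel₀ (hc0 t), mul_one]
  have hexp : ∀ (R : Finset ℂ) (b : ℂ → ℂ), ∑ t ∈ R, b t • linForm (m := 2) (φ t) ^ d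
      = ∑ j ∈ Finset.range (2 * M + 1), (∑ t ∈ R, b t * t ^ j) • W j := by
    intro R b
    simp_rw [hW, Finset.smul_sum, Finset.sum_smul, smul_smul]
    exact Finset.sum_comm
  have key := key_one M S hScard (fun t => a (ψ t) * (c t)⁻¹)
  have hinjB : Set.InjOn (fun S' : Finset ℂ => S'.image ψ) Set.univ := by
    intro x _ y _ h
    exact Finset.image_injective hinj h
  set K := {S' : Finset ℂ | S'.card = M + 1 ∧ ∃ b : ℂ → ℂ, ∀ j ≤ 2 * M,
      ∑ t ∈ S, (fun t => a (ψ t) * (c t)⁻¹) t * t ^ j = ∑ t ∈ S', b t * t ^ j} with hK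
  let f : Finset ℂ → Finset (Pt 2) := fun S' => S'.image ψ ∪ (A \ A')
  have himg : (f '' K).Infinite := by
    intro hfin
    apply key
    refine Set.Finite.of_finite_fibers f hfin ?_
    rintro B _
    refine Set.Finite.subset (Finset.finite_toSet (B.preimage ψ hinj.injOn).powerset) ?_
    rintro S' ⟨_, hS'⟩
    simp only [Set.mem_preimage, Set.mem_singleton_iff] at hS'
    simp only [Finset.mem_coe, Finset.mem_powerset]
    intro t ht
    rw [Finset.mem_preimage, ← hS']
    exact Finset.mem_union_left _ (Finset.mem_image_of_mem _ ht)
  refine himg.mono ?_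
  rintro _ ⟨S', ⟨hS'c, b, hb⟩, rfl⟩
  refine ⟨?_, ?_⟩
  · apply isDecomp_of_sum
    have hT : T = ∑ t ∈ S', b t • linForm (m := 2) (φ t) ^ d + ∑ P ∈ A \ A', a P • powRep d P := by
      rw [ha, ← Finset.sum_sdiff hA', add_comm, hsumA', hexp, hexp]
      congr 1
      refine Finset.sum_congr rfl fun j hj => ?_
      rw [← hb j (by have := Finset.mem_range.1 hj; omega)]
    rw [hT]
    refine Submodule.add_mem _ (Submodule.sum_mem _ fun t ht => ?_)
      (Submodule.sum_mem _ fun P hP => ?_)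
    · rw [hc t]
      refine Submodule.smul_mem _ _ (Submodule.smul_mem _ _ (Submodule.subset_span ⟨ψ t, ?_, rfl⟩))
      exact Finset.mem_coe.2 (Finset.mem_union_left _ (Finset.mem_image_of_mem _ ht))
    · refine Submodule.smul_mem _ _ (Submodule.subset_span ⟨P, ?_, rfl⟩)
      exact Finset.mem_coe.2 (Finset.mem_union_right _ hP)
  · refine (Finset.card_union_le _ _).trans ?_
    rw [Finset.card_sdiff_of_subset hA', Finset.card_image_of_injective _ hinj, hS'c, hcard]
    have := Finset.card_le_card hA'
    omega

lemma rnc_param {d e M : ℕ} (he : 1 ≤ e) (hM : e * d = 2 * M) (V : Fin (e + 1) → Fin 3 → ℂ)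
    (hV : LinearIndependent ℂ V)
    (T : MvPolynomial (Fin 3) ℂ) (A A' : Finset (Pt 2)) (hA : IsDecomp d A T) (hA' : A' ⊆ A)
    (hcard : M + 1 ≤ A'.card)
    (hcov : ∀ P ∈ A', ∃ s t c : ℂ, P.rep = c • ∑ j : Fin (e + 1), (s ^ (j : ℕ) * t ^ (e - j)) • V j) :
    {B : Finset (Pt 2) | IsDecomp d B T ∧ B.card = A.card}.Infinite := by
  obtain ⟨A₁, hA₁, hc₁⟩ := Finset.exists_subset_card_eq hcard
  choose! s t c hst using hcov
  obtain ⟨t0, ht0⟩ : ∃ t0 : ℂ, t0 ∉ A₁.image (fun P => t P / s P) :=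
    Infinite.exists_notMem_finset _
  have hcoef : ∀ a b : Fin (e + 1) → ℂ, ∑ j, a j • V j = ∑ j, b j • V j → a = b := by
    intro a b hab
    have h1 := Fintype.linearIndependent_iff.1 hV (fun j => a j - b j) (by
      simp only [sub_smul, Finset.sum_sub_distrib, hab, sub_self])
    funext j; exact sub_eq_zero.1 (h1 j)
  set φ : ℂ → Fin 3 → ℂ := fun x => ∑ j : Fin (e + 1), (x ^ (j : ℕ) * (1 + t0 * x) ^ (e - j)) • V j
    with hφ
  have hne : ∀ x, φ x ≠ 0 := by
    intro x hx
    have h1 := hcoef _ 0 (hx.trans (by simp))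
    have h2 := congrFun h1 0
    have h3 := congrFun h1 (Fin.last e)
    simp at h2 h3
    obtain ⟨h3, _⟩ := h3
    rw [h3] at h2; simp at h2
  refine affine_param hM
    (fun i => ∑ j : Fin (e + 1), Polynomial.C (V j i) *
      (Polynomial.X ^ (j : ℕ) * (1 + Polynomial.C t0 * Polynomial.X) ^ (e - j)))
    ?_ φ ?_ hne ?_ T A A₁ hA (hA₁.trans hA') hc₁ ?_
  · intro i
    refine Polynomial.natDegree_sum_le_of_forall_le _ _ fun j _ => ?_
    refine (Polynomial.natDegree_C_mul_le _ _).trans ?_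
    refine Polynomial.natDegree_mul_le.trans ?_
    have h1 : (1 + Polynomial.C t0 * Polynomial.X : Polynomial ℂ).natDegree ≤ 1 := by
      compute_degree
    have h2 := Polynomial.natDegree_pow_le_of_le (e - (j : ℕ)) h1
    have h3 := Polynomial.natDegree_X_pow_le (R := ℂ) (j : ℕ)
    have := j.2
    omega
  · intro x i
    simp only [hφ, Finset.sum_apply, Pi.smul_apply, smul_eq_mul, Polynomial.eval_finsetSum,
      Polynomial.eval_mul, Polynomial.eval_C, Polynomial.eval_pow, Polynomial.eval_X,
      Polynomial.eval_add, Polynomial.eval_one]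
    exact Finset.sum_congr rfl fun j _ => by ring
  · intro x y hxy
    simp only at hxy
    rw [Projectivization.mk_eq_mk_iff'] at hxy
    obtain ⟨a, ha⟩ := hxy
    simp only [hφ, Finset.smul_sum, smul_smul] at ha
    have h1 := hcoef _ _ ha
    have h2 := congrFun h1 (Fin.last e)
    have h3 := congrFun h1 ⟨e - 1, by omega⟩
    simp only [Fin.val_last, Nat.sub_self, pow_zero, mul_one] at h2
    rw [show e - (e - 1) = 1 by omega] at h3
    simp only [pow_one] at h3
    obtain ⟨k, rfl⟩ : ∃ k, e = k + 1 := ⟨e - 1, by omega⟩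
    simp only [Nat.add_sub_cancel] at h3
    by_cases hx : x = 0
    · subst hx
      have ha0 : a ≠ 0 := by
        rintro rfl
        have h4 := congrFun h1 0
        simp at h4
      rw [zero_pow (by omega)] at h2
      rcases mul_eq_zero.1 h2 with h | h
      · exact absurd h ha0
      · exact (pow_eq_zero_iff (by omega)).1 h |>.symm
    · have hxk : x ^ k ≠ 0 := pow_ne_zero _ hx
      have h5 : x ^ k * (y * (1 + t0 * x)) = x ^ k * (x * (1 + t0 * y)) := by
        linear_combination (1 + t0 * y) * h2 - y * h3
      have h6 := mul_left_cancel₀ hxk h5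
      linear_combination -h6
  · intro P hP
    have h1 := hst P (hA₁ hP)
    have hts : t P - t0 * s P ≠ 0 := by
      intro h0
      by_cases hs : s P = 0
      · have ht : t P = 0 := by simpa [hs] using h0
        apply P.rep_nonzero
        rw [h1, Finset.sum_eq_zero, smul_zero]
        intro j _
        rw [hs, ht, ← pow_add, zero_pow (by have := j.2; omega), zero_smul]
      · apply ht0
        refine Finset.mem_image.2 ⟨P, hP, ?_⟩
        field_simp
        linear_combination h0
    refine ⟨s P / (t P - t0 * s P), ?_⟩
    conv_rhs => rw [← P.mk_rep]
    rw [Projectivization.mk_eq_mk_iff']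
    have hc0 : c P ≠ 0 := by
      intro h0; apply P.rep_nonzero; rw [h1, h0, zero_smul]
    refine ⟨(c P)⁻¹ * ((t P - t0 * s P) ^ e)⁻¹, ?_⟩
    rw [h1, smul_smul, mul_right_comm, inv_mul_cancel₀ hc0, one_mul, Finset.smul_sum]
    refine Finset.sum_congr rfl fun j _ => ?_
    rw [smul_smul]
    congr 1
    have h2 : 1 + t0 * (s P / (t P - t0 * s P)) = t P / (t P - t0 * s P) := by
      field_simp; ring
    have h3 : (t P - t0 * s P) ^ e = (t P - t0 * s P) ^ (j : ℕ) * (t P - t0 * s P) ^ (e - j) := by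
      rw [← pow_add]; congr 1; have := j.2; omega
    rw [h2, h3, div_pow, div_pow]
    field_simp

lemma line_case {d M : ℕ} (hM : d = 2 * M) (f : (Fin 3 → ℂ) →ₗ[ℂ] ℂ) (hf : f ≠ 0)
    (T : MvPolynomial (Fin 3) ℂ) (A A' : Finset (Pt 2)) (hA : IsDecomp d A T) (hA' : A' ⊆ A)
    (hcard : M + 1 ≤ A'.card) (hz : ∀ P ∈ A', f P.rep = 0) :
    {B : Finset (Pt 2) | IsDecomp d B T ∧ B.card = A.card}.Infinite := by
  have hfr : Module.finrank ℂ (LinearMap.ker f) = 2 := by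
    have h1 := LinearMap.finrank_range_add_finrank_ker f
    have h2 : LinearMap.range f = ⊤ := LinearMap.range_eq_top.2 (LinearMap.surjective hf)
    rw [h2] at h1
    simp at h1
    omega
  let b := Module.finBasisOfFinrankEq ℂ (LinearMap.ker f) hfr
  refine rnc_param (e := 1) (M := M) le_rfl (by omega) (fun j => (b j : Fin 3 → ℂ)) ?_
    T A A' hA hA' hcard ?_
  · exact b.linearIndependent.map' (LinearMap.ker f).subtype (Submodule.ker_subtype _)
  · intro P hP
    have h1 := b.sum_repr ⟨P.rep, hz P hP⟩
    have h2 := congrArg Subtype.val h1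
    simp only [Fin.sum_univ_two, Submodule.coe_add, Submodule.coe_smul] at h2
    refine ⟨b.repr ⟨P.rep, hz P hP⟩ 1, b.repr ⟨P.rep, hz P hP⟩ 0, 1, ?_⟩
    refine h2.symm.trans ?_
    simp [Fin.sum_univ_two]

lemma two_lines {d M : ℕ} (hM : d = 2 * M) (f g : (Fin 3 → ℂ) →ₗ[ℂ] ℂ) (hf : f ≠ 0) (hg : g ≠ 0)
    (T : MvPolynomial (Fin 3) ℂ) (A A' : Finset (Pt 2)) (hA : IsDecomp d A T) (hA' : A' ⊆ A)
    (hcard : 2 * M + 1 ≤ A'.card) (hz : ∀ P ∈ A', f P.rep * g P.rep = 0) :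
    {B : Finset (Pt 2) | IsDecomp d B T ∧ B.card = A.card}.Infinite := by
  have h1 := Finset.card_filter_add_card_filter_not (s := A') (fun P => f P.rep = 0)
  by_cases h : M + 1 ≤ (A'.filter (fun P => f P.rep = 0)).card
  · exact line_case hM f hf T A _ hA ((Finset.filter_subset _ _).trans hA') h
      (fun P hP => (Finset.mem_filter.1 hP).2)
  · refine line_case hM g hg T A (A'.filter (fun P => ¬ f P.rep = 0)) hA
      ((Finset.filter_subset _ _).trans hA') (by omega) ?_
    intro P hP
    obtain ⟨h2, h3⟩ := Finset.mem_filter.1 hP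
    exact (mul_eq_zero.1 (hz P h2)).resolve_left h3

lemma quad_of_hom (Q : MvPolynomial (Fin 3) ℂ) (hQ : Q.IsHomogeneous 2) :
    ∃ q : QuadraticForm ℂ (Fin 3 → ℂ), ∀ v, q v = eval v Q := by
  have hlin : ∀ p ∈ homogeneousSubmodule (Fin 3) ℂ 1,
      ∃ f : (Fin 3 → ℂ) →ₗ[ℂ] ℂ, ∀ v, f v = eval v p := by
    intro p hp
    rw [homogeneousSubmodule_one_eq_span_X] at hp
    induction hp using Submodule.span_induction with
    | mem x h => obtain ⟨i, rfl⟩ := h; exact ⟨LinearMap.proj i, fun v => by simp⟩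
    | zero => exact ⟨0, by simp⟩
    | add x y _ _ hx hy =>
      obtain ⟨f, hf⟩ := hx; obtain ⟨g, hg⟩ := hy
      exact ⟨f + g, fun v => by simp [hf, hg]⟩
    | smul a x _ hx =>
      obtain ⟨f, hf⟩ := hx
      exact ⟨a • f, fun v => by simp [hf, smul_eval]⟩
  have hmem : Q ∈ homogeneousSubmodule (Fin 3) ℂ 1 * homogeneousSubmodule (Fin 3) ℂ 1 := by
    rw [← pow_two, homogeneousSubmodule_one_pow]; exact hQ
  induction hmem using Submodule.mul_induction_on' with
  | mem_mul_mem m hm n hn =>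
    obtain ⟨f, hf⟩ := hlin m hm; obtain ⟨g, hg⟩ := hlin n hn
    exact ⟨QuadraticMap.linMulLin f g, fun v => by simp [hf, hg]⟩
  | add x hx y hy ihx ihy =>
    have hx' : x.IsHomogeneous 2 := homogeneousSubmodule_mul 1 1 hx
    have hy' : y.IsHomogeneous 2 := homogeneousSubmodule_mul 1 1 hy
    obtain ⟨q, h⟩ := ihx hx'; obtain ⟨q', h'⟩ := ihy hy'
    exact ⟨q + q', fun v => by simp [h, h']⟩

lemma diag_of_hom (Q : MvPolynomial (Fin 3) ℂ) (hQ : Q.IsHomogeneous 2) :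
    ∃ (L : (Fin 3 → ℂ) ≃ₗ[ℂ] (Fin 3 → ℂ)) (s : Fin 3 → ℂ), ∀ v,
      eval v Q = (s 0 * L v 0) ^ 2 + (s 1 * L v 1) ^ 2 + (s 2 * L v 2) ^ 2 := by
  obtain ⟨q, hq⟩ := quad_of_hom Q hQ
  have h := QuadraticForm.equivalent_weightedSumSquares q
  rw [show Module.finrank ℂ (Fin 3 → ℂ) = 3 by simp] at h
  obtain ⟨w, ⟨L⟩⟩ := h
  choose s hs using fun i => IsAlgClosed.exists_pow_nat_eq (w i) (n := 2) (by norm_num)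
  refine ⟨L.toLinearEquiv, s, fun v => ?_⟩
  have h1 := L.map_app v
  rw [← hq, ← h1, QuadraticMap.weightedSumSquares_apply, Fin.sum_univ_three]
  simp only [mul_pow, hs, smul_eq_mul, ← pow_two]
  rfl

lemma reducible_case {d M : ℕ} (hM : d = 2 * M) (y z : (Fin 3 → ℂ) →ₗ[ℂ] ℂ)
    (Q : MvPolynomial (Fin 3) ℂ) (hQ0 : Q ≠ 0)
    (hQ : ∀ v, eval v Q = (y v) ^ 2 + (z v) ^ 2)
    (T : MvPolynomial (Fin 3) ℂ) (A A' : Finset (Pt 2)) (hA : IsDecomp d A T) (hA' : A' ⊆ A)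
    (hcard : 2 * M + 1 ≤ A'.card) (hz : ∀ P ∈ A', eval P.rep Q = 0) :
    {B : Finset (Pt 2) | IsDecomp d B T ∧ B.card = A.card}.Infinite := by
  have hfac : ∀ v, eval v Q = (y + Complex.I • z) v * (y - Complex.I • z) v := by
    intro v
    rw [hQ]
    simp only [LinearMap.add_apply, LinearMap.sub_apply, LinearMap.smul_apply, smul_eq_mul]
    linear_combination (z v) ^ 2 * Complex.I_sq
  refine two_lines hM (y + Complex.I • z) (y - Complex.I • z) ?_ ?_ T A A' hA hA' hcard ?_
  · intro h; apply hQ0; apply MvPolynomial.funext; intro v; rw [hfac, h]; simp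
  · intro h; apply hQ0; apply MvPolynomial.funext; intro v; rw [hfac, h]; simp
  · intro P hP; rw [← hfac]; exact hz P hP

lemma smooth_case {d : ℕ} (L : (Fin 3 → ℂ) ≃ₗ[ℂ] (Fin 3 → ℂ)) (s : Fin 3 → ℂ)
    (hs : ∀ i, s i ≠ 0)
    (T : MvPolynomial (Fin 3) ℂ) (A A' : Finset (Pt 2)) (hA : IsDecomp d A T) (hA' : A' ⊆ A)
    (hcard : d + 1 ≤ A'.card)
    (hz : ∀ P ∈ A', (s 0 * L P.rep 0) ^ 2 + (s 1 * L P.rep 1) ^ 2 + (s 2 * L P.rep 2) ^ 2 = 0) :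
    {B : Finset (Pt 2) | IsDecomp d B T ∧ B.card = A.card}.Infinite := by
  let p : Fin 3 → (Fin 3 → ℂ) →ₗ[ℂ] ℂ := fun i => s i • LinearMap.proj i
  let N : (Fin 3 → ℂ) →ₗ[ℂ] (Fin 3 → ℂ) :=
    LinearMap.pi ![p 0 - Complex.I • p 1, Complex.I • p 2, p 0 + Complex.I • p 1]
  have hN0 : ∀ v, N v 0 = s 0 * v 0 - Complex.I * (s 1 * v 1) := fun v => by simp [N, p]
  have hN1 : ∀ v, N v 1 = Complex.I * (s 2 * v 2) := fun v => by simp [N, p]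
  have hN2 : ∀ v, N v 2 = s 0 * v 0 + Complex.I * (s 1 * v 1) := fun v => by simp [N, p]
  have hNinj : Function.Injective N := by
    rw [← LinearMap.ker_eq_bot, LinearMap.ker_eq_bot']
    intro v hv
    have h0 := hN0 v; have h1 := hN1 v; have h2 := hN2 v
    rw [hv] at h0 h1 h2
    simp only [Pi.zero_apply] at h0 h1 h2
    have e0 : s 0 * v 0 = 0 := by linear_combination -(h0 + h2) / 2
    have e1 : s 1 * v 1 = 0 := by
      apply mul_left_cancel₀ Complex.I_ne_zero; linear_combination (h0 - h2) / 2
    have e2 : s 2 * v 2 = 0 := by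
      apply mul_left_cancel₀ Complex.I_ne_zero; linear_combination -h1
    funext i
    fin_cases i
    · exact (mul_eq_zero.1 e0).resolve_left (hs 0)
    · exact (mul_eq_zero.1 e1).resolve_left (hs 1)
    · exact (mul_eq_zero.1 e2).resolve_left (hs 2)
  let Z : (Fin 3 → ℂ) ≃ₗ[ℂ] (Fin 3 → ℂ) := L.trans (LinearEquiv.ofInjectiveEndo N hNinj)
  have hZ : ∀ v, Z v = N (L v) := fun v => by simp [Z]
  let b := Module.Basis.ofEquivFun Z
  refine rnc_param (e := 2) (M := d) (by norm_num) rfl b b.linearIndependent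
    T A A' hA hA' hcard ?_
  intro P hP
  have h := hz P hP
  have h1 := b.sum_repr P.rep
  have hr : ∀ i, b.repr P.rep i = Z P.rep i := fun i => by simp [b]
  rw [Fin.sum_univ_three, hr, hr, hr, hZ] at h1
  have hrel : N (L P.rep) 0 * N (L P.rep) 2 = N (L P.rep) 1 ^ 2 := by
    rw [hN0, hN1, hN2]
    linear_combination h - ((s 1 * L P.rep 1) ^ 2 + (s 2 * L P.rep 2) ^ 2) * Complex.I_sq
  set v := N (L P.rep) with hv
  by_cases hU : v 2 = 0
  · have hW : v 1 = 0 := by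
      rw [hU, mul_zero] at hrel
      exact (pow_eq_zero_iff (by norm_num)).1 hrel.symm
    refine ⟨0, 1, v 0, ?_⟩
    conv_lhs => rw [← h1]
    simp [Fin.sum_univ_three, hU, hW]
  · refine ⟨v 2, v 1, (v 2)⁻¹, ?_⟩
    conv_lhs => rw [← h1]
    have e0 : v 0 = (v 2)⁻¹ * v 1 ^ 2 := by
      rw [← hrel]; field_simp
    rw [Fin.sum_univ_three, smul_add, smul_add, smul_smul, smul_smul, smul_smul, e0]
    congr 2
    · simp
    · congr 1; simp [hU]
    · simp; field_simp

/-- If a decomposition `A` of a ternary form `T` of degree `8+2n`, of length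
`r ≤ 11+3n`, contains at least `9+2n` points lying on a conic, then `T` admits infinitely
many decompositions of length `r`. -/
theorem stmt4 (n : ℕ) (T : MvPolynomial (Fin 3) ℂ) (hT0 : T ≠ 0)
    (hThom : T.IsHomogeneous (8 + 2 * n))
    (A : Finset (Pt 2)) (hA : IsDecomp (8 + 2 * n) A T)
    (hr : A.card ≤ 11 + 3 * n)
    (hconic : ∃ A' ⊆ A, 9 + 2 * n ≤ A'.card ∧
      ∃ Q : MvPolynomial (Fin 3) ℂ, Q ≠ 0 ∧ Q.IsHomogeneous 2 ∧
        ∀ P ∈ A', eval (Projectivization.rep P) Q = 0) :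
    {B : Finset (Pt 2) | IsDecomp (8 + 2 * n) B T ∧ B.card = A.card}.Infinite := by
  obtain ⟨A', hA', hcard, Q, hQ0, hQ2, hz⟩ := hconic
  obtain ⟨L, s, hL⟩ := diag_of_hom Q hQ2
  let p : Fin 3 → (Fin 3 → ℂ) →ₗ[ℂ] ℂ := fun i => s i • (LinearMap.proj i ∘ₗ L.toLinearMap)
  have hp : ∀ i v, p i v = s i * L v i := fun i v => by simp [p]
  have hM : 8 + 2 * n = 2 * (4 + n) := by ring
  by_cases h0 : s 0 = 0
  · exact reducible_case hM (p 1) (p 2) Q hQ0 (fun v => by rw [hL, hp, hp, h0]; ring)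
      T A A' hA hA' (by omega) hz
  by_cases h1 : s 1 = 0
  · exact reducible_case hM (p 0) (p 2) Q hQ0 (fun v => by rw [hL, hp, hp, h1]; ring)
      T A A' hA hA' (by omega) hz
  by_cases h2 : s 2 = 0
  · exact reducible_case hM (p 0) (p 1) Q hQ0 (fun v => by rw [hL, hp, hp, h2]; ring)
      T A A' hA hA' (by omega) hz
  refine smooth_case L s ?_ T A A' hA hA' (by omega) (fun P hP => by rw [← hL]; exact hz P hP)
  intro i
  fin_cases i
  · exact h0
  · exact h1
  · exact h2

end
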